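/- For all real numbers a₁₂, a₁₃, a₂₃, b₁₂, b₁₃, the bracket of 𝔤(a₁₂,a₁₃,a₂₃,b₁₂,b₁₃) satisfies the Jacobi identity, i.e., 𝔤(a₁₂,a₁₃,a₂₃,b₁₂,b₁₃) is a real Lie algebra. -/

import Mathlib

/-!
STATEMENT 7: the bracket of 𝔤(a₁₂,a₁₃,a₂₃,b₁₂,b₁₃) satisfies the Jacobi identity.
-/

/-- The skew-symmetric bilinear bracket on `ℝ³` determined by
`[e₁,e₂] = −a₁₂e₁ − b₁₂e₂ + (a₂₃−b₁₃)e₃`, `[e₁,e₃] = −a₁₃e₁ − b₁₃e₂ + b₁₂e₃`,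
`[e₂,e₃] = −a₂₃e₁ + a₁₃e₂ − a₁₂e₃`. -/
def harmBracket (a₁₂ a₁₃ a₂₃ b₁₂ b₁₃ : ℝ) (u v : Fin 3 → ℝ) : Fin 3 → ℝ :=
  (u 0 * v 1 - u 1 * v 0) • ![-a₁₂, -b₁₂, a₂₃ - b₁₃] +
    (u 0 * v 2 - u 2 * v 0) • ![-a₁₃, -b₁₃, b₁₂] +
    (u 1 * v 2 - u 2 * v 1) • ![-a₂₃, a₁₃, -a₁₂]

/-- For all real `a₁₂, a₁₃, a₂₃, b₁₂, b₁₃`, the bracket of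
`𝔤(a₁₂,a₁₃,a₂₃,b₁₂,b₁₃)` satisfies the Jacobi identity, so it is a real Lie algebra. -/
theorem harmBracket_jacobi (a₁₂ a₁₃ a₂₃ b₁₂ b₁₃ : ℝ) (x y z : Fin 3 → ℝ) :
    harmBracket a₁₂ a₁₃ a₂₃ b₁₂ b₁₃ x (harmBracket a₁₂ a₁₃ a₂₃ b₁₂ b₁₃ y z) +
        harmBracket a₁₂ a₁₃ a₂₃ b₁₂ b₁₃ y (harmBracket a₁₂ a₁₃ a₂₃ b₁₂ b₁₃ z x) +
        harmBracket a₁₂ a₁₃ a₂₃ b₁₂ b₁₃ z (harmBracket a₁₂ a₁₃ a₂₃ b₁₂ b₁₃ x y) = 0 := by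
  funext i
  fin_cases i <;> simp [harmBracket] <;> ring
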